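/- arXiv:2006.02048 — 4 statements merged into one kernel-verified Lean document; each statement's English description precedes it below -/
import Mathlib

section
/- Simulation lemma: For every pair of senders i ≠ j and every signal π_j of sender j, there exists a signal π_i of sender i such that the induced joint distribution of ((ω_i, ω_R), a) under π_i equals the induced joint distribution of ((ω_i, ω_R), a) under π_j; equivalently, for every message a ∈ A, P(π_i = a) = P(π_j = a) and, whenever P(π_j = a) > 0, the posterior distribution of (ω_i, ω_R) given π_i = a equals the posterior distribution of (ω_i, ω_R) given π_j = a. -/
open Finset

namespace Persuasion

variable {n : ℕ} {A ΩR : Type} {Ω : Fin n → Type}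
variable [Fintype A] [Fintype ΩR] [∀ k, Fintype (Ω k)]
variable [DecidableEq ΩR] [∀ k, DecidableEq (Ω k)]

/-- A signal for sender `k`: a map from `k`'s and the receiver's states to
distributions over messages/actions. -/
def IsSignal {k : Fin n} (π : Ω k × ΩR → A → ℝ) : Prop :=
  (∀ s a, 0 ≤ π s a) ∧ ∀ s, ∑ a, π s a = 1

/-- The joint distribution on `Ω × A` induced by the prior `μ0` and sender `k`'s signal `π`. -/
def jointP (μ0 : ((∀ k, Ω k) × ΩR) → ℝ) {k : Fin n}
    (π : Ω k × ΩR → A → ℝ) (ω : (∀ k, Ω k) × ΩR) (a : A) : ℝ :=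
  μ0 ω * π (ω.1 k, ω.2) a

/-- The probability that the signal `π` is realized as the message `a`. -/
def Pmsg (μ0 : ((∀ k, Ω k) × ΩR) → ℝ) {k : Fin n}
    (π : Ω k × ΩR → A → ℝ) (a : A) : ℝ :=
  ∑ ω, jointP μ0 π ω a

/-- The joint probability that `(ω_i, ω_R) = (ωi, ωR)` and the message is `a`. -/
def margIR (μ0 : ((∀ k, Ω k) × ΩR) → ℝ) {k : Fin n}
    (π : Ω k × ΩR → A → ℝ) (i : Fin n) (ωi : Ω i) (ωR : ΩR) (a : A) : ℝ :=
  ∑ ω ∈ univ.filter (fun ω : (∀ k, Ω k) × ΩR => ω.1 i = ωi ∧ ω.2 = ωR), jointP μ0 π ω a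

/-- The joint probability that `ω_i = ωi` and the message is `a`. -/
def margI (μ0 : ((∀ k, Ω k) × ΩR) → ℝ) {k : Fin n}
    (π : Ω k × ΩR → A → ℝ) (i : Fin n) (ωi : Ω i) (a : A) : ℝ :=
  ∑ ω ∈ univ.filter (fun ω : (∀ k, Ω k) × ΩR => ω.1 i = ωi), jointP μ0 π ω a

/-- The joint probability that `ω_R = ωR` and the message is `a`. -/
def margR (μ0 : ((∀ k, Ω k) × ΩR) → ℝ) {k : Fin n}
    (π : Ω k × ΩR → A → ℝ) (ωR : ΩR) (a : A) : ℝ :=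
  ∑ ω ∈ univ.filter (fun ω : (∀ k, Ω k) × ΩR => ω.2 = ωR), jointP μ0 π ω a

/-- The posterior probability of `(ω_i, ω_R) = (ωi, ωR)` given that the message is `a`. -/
noncomputable def posterior (μ0 : ((∀ k, Ω k) × ΩR) → ℝ) {k : Fin n}
    (π : Ω k × ΩR → A → ℝ) (i : Fin n) (ωi : Ω i) (ωR : ΩR) (a : A) : ℝ :=
  margIR μ0 π i ωi ωR a / Pmsg μ0 π a

/-- `E[u_R(b, ω_R) | π = a]`. -/
noncomputable def condExpR (μ0 : ((∀ k, Ω k) × ΩR) → ℝ) {k : Fin n}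
    (π : Ω k × ΩR → A → ℝ) (uR : A → ΩR → ℝ) (a b : A) : ℝ :=
  (∑ ω, jointP μ0 π ω a * uR b ω.2) / Pmsg μ0 π a

/-- Incentive compatibility: each realized message `a` is an optimal action for the
receiver given the posterior it induces. -/
def IC (μ0 : ((∀ k, Ω k) × ΩR) → ℝ) {k : Fin n}
    (π : Ω k × ΩR → A → ℝ) (uR : A → ΩR → ℝ) : Prop :=
  ∀ a, 0 < Pmsg μ0 π a → ∀ b, condExpR μ0 π uR a b ≤ condExpR μ0 π uR a a

/-- The receiver's expected utility `E[u_R(a, ω_R)]` from following the signal `π`. -/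
def vR (μ0 : ((∀ k, Ω k) × ΩR) → ℝ) {k : Fin n}
    (π : Ω k × ΩR → A → ℝ) (uR : A → ΩR → ℝ) : ℝ :=
  ∑ a, ∑ ω, jointP μ0 π ω a * uR a ω.2

/-- Sender `i`'s expected utility `E[u_i(a, ω_i)]` when the receiver follows signal `π`
(of sender `k`). -/
def vS (μ0 : ((∀ k, Ω k) × ΩR) → ℝ) {k : Fin n}
    (π : Ω k × ΩR → A → ℝ) (i : Fin n) (ui : A → Ω i → ℝ) : ℝ :=
  ∑ a, ∑ ω, jointP μ0 π ω a * ui a (ω.1 i)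

/-- The set of maximizers of `u` over `A`. -/
noncomputable def argmaxSet (u : A → ℝ) : Finset A :=
  univ.filter (fun a => ∀ b, u b ≤ u a)

/-- A signal is fully informative if any realized message `a`, in any receiver state `ωR`
that has positive probability jointly with `a`, is the receiver's unique optimal action. -/
noncomputable def FullyInformative (μ0 : ((∀ k, Ω k) × ΩR) → ℝ) {k : Fin n}
    (π : Ω k × ΩR → A → ℝ) (uR : A → ΩR → ℝ) : Prop :=
  ∀ a ωR, 0 < margR μ0 π ωR a → argmaxSet (fun b => uR b ωR) = {a}

/-- Assumption 1: every player has a unique optimal action in each of his states. -/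
noncomputable def Assumption1 (uR : A → ΩR → ℝ) (u : ∀ k : Fin n, A → Ω k → ℝ) : Prop :=
  (∀ ωR, (argmaxSet (fun a => uR a ωR)).card = 1) ∧
  ∀ (k : Fin n) (ωk : Ω k), (argmaxSet (fun a => u k a ωk)).card = 1

/-- Assumption 2: conditional on any positive-probability `(ω_j, ω_R)`, any other sender `i`
has, with positive probability, a state in which his preferences agree with the receiver's. -/
noncomputable def Assumption2 (μ0 : ((∀ k, Ω k) × ΩR) → ℝ) (uR : A → ΩR → ℝ)
    (u : ∀ k : Fin n, A → Ω k → ℝ) : Prop :=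
  ∀ i j : Fin n, i ≠ j → ∀ (ωj : Ω j) (ωR : ΩR),
    (0 < ∑ ω ∈ univ.filter (fun ω : (∀ k, Ω k) × ΩR => ω.1 j = ωj ∧ ω.2 = ωR), μ0 ω) →
    ∃ ωi : Ω i,
      (0 < ∑ ω ∈ univ.filter
        (fun ω : (∀ k, Ω k) × ΩR => ω.1 i = ωi ∧ ω.1 j = ωj ∧ ω.2 = ωR), μ0 ω) ∧
      argmaxSet (fun a => u i a ωi) = argmaxSet (fun a => uR a ωR)

/-- `E_{μ0}[max_{a ∈ A} u_R(a, ω_R)]`: the receiver's first-best expected utility. -/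
noncomputable def Emax [Nonempty A] (μ0 : ((∀ k, Ω k) × ΩR) → ℝ) (uR : A → ΩR → ℝ) : ℝ :=
  ∑ ω : (∀ k, Ω k) × ΩR, μ0 ω * univ.sup' univ_nonempty (fun a => uR a ω.2)

/-- The set of senders whose signals the receiver weakly prefers to all others. -/
noncomputable def BestSet (μ0 : ((∀ k, Ω k) × ΩR) → ℝ)
    (π : ∀ k : Fin n, Ω k × ΩR → A → ℝ) (uR : A → ΩR → ℝ) : Finset (Fin n) :=
  univ.filter (fun j => ∀ k, vR μ0 (π k) uR ≤ vR μ0 (π j) uR)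

/-- Sender `i`'s expected payoff under the uniform tie-breaking decision rule. -/
noncomputable def senderPayoff (μ0 : ((∀ k, Ω k) × ΩR) → ℝ)
    (π : ∀ k : Fin n, Ω k × ΩR → A → ℝ) (uR : A → ΩR → ℝ)
    (i : Fin n) (ui : A → Ω i → ℝ) : ℝ :=
  (∑ j ∈ BestSet μ0 π uR, vS μ0 (π j) i ui) / (BestSet μ0 π uR).card

/-- A pure Nash equilibrium of the persuasion game with the uniform tie-breaking rule. -/
noncomputable def PureNE (μ0 : ((∀ k, Ω k) × ΩR) → ℝ)
    (π : ∀ k : Fin n, Ω k × ΩR → A → ℝ) (uR : A → ΩR → ℝ)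
    (u : ∀ k : Fin n, A → Ω k → ℝ) : Prop :=
  (∀ k, IsSignal (π k) ∧ IC μ0 (π k) uR) ∧
  ∀ (i : Fin n) (π' : Ω i × ΩR → A → ℝ), IsSignal π' → IC μ0 π' uR →
    senderPayoff μ0 (Function.update π i π') uR i (u i) ≤ senderPayoff μ0 π uR i (u i)


/-- An optimal decision rule: for each profile of IC signals, a distribution over senders
supported on senders whose signals the receiver weakly prefers to all others. -/
def IsOptimalRule (μ0 : ((∀ k, Ω k) × ΩR) → ℝ) (uR : A → ΩR → ℝ)
    (D : (∀ k : Fin n, Ω k × ΩR → A → ℝ) → Fin n → ℝ) : Prop :=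
  ∀ π : ∀ k : Fin n, Ω k × ΩR → A → ℝ,
    (∀ k, IsSignal (π k) ∧ IC μ0 (π k) uR) →
    (∀ j, 0 ≤ D π j) ∧ (∑ j, D π j = 1) ∧
    ∀ i, 0 < D π i → ∀ j, vR μ0 (π j) uR ≤ vR μ0 (π i) uR

/-- Sender `i`'s expected payoff from profile `π` under decision rule `D`. -/
def payoffUnder (μ0 : ((∀ k, Ω k) × ΩR) → ℝ)
    (D : (∀ k : Fin n, Ω k × ΩR → A → ℝ) → Fin n → ℝ)
    (π : ∀ k : Fin n, Ω k × ΩR → A → ℝ) (i : Fin n) (ui : A → Ω i → ℝ) : ℝ :=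
  ∑ j, D π j * vS μ0 (π j) i ui

/-- A pure pessimistic Nash equilibrium: a profile of IC signals together with an optimal
decision rule `D` such that every unilateral IC deviation of a sender is unprofitable under
*some* optimal decision rule after the deviation. -/
def PessimisticNE (μ0 : ((∀ k, Ω k) × ΩR) → ℝ)
    (π : ∀ k : Fin n, Ω k × ΩR → A → ℝ) (uR : A → ΩR → ℝ)
    (u : ∀ k : Fin n, A → Ω k → ℝ)
    (D : (∀ k : Fin n, Ω k × ΩR → A → ℝ) → Fin n → ℝ) : Prop :=
  (∀ k, IsSignal (π k) ∧ IC μ0 (π k) uR) ∧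
  IsOptimalRule μ0 uR D ∧
  ∀ (i : Fin n) (π' : Ω i × ΩR → A → ℝ), IsSignal π' → IC μ0 π' uR →
    ∃ D', IsOptimalRule μ0 uR D' ∧
      payoffUnder μ0 D' (Function.update π i π') i (u i) ≤ payoffUnder μ0 D π i (u i)

/-- The prior probability that `(ω_i, ω_R) = (ωi, ωR)`. -/
def priorIR (μ0 : ((∀ k, Ω k) × ΩR) → ℝ) (i : Fin n) (ωi : Ω i) (ωR : ΩR) : ℝ :=
  ∑ ω ∈ univ.filter (fun ω : (∀ k, Ω k) × ΩR => ω.1 i = ωi ∧ ω.2 = ωR), μ0 ω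

set_option linter.unusedSectionVars false in
theorem margIR_nonneg {μ0 : ((∀ k, Ω k) × ΩR) → ℝ} (hμ0 : ∀ ω, 0 ≤ μ0 ω) {k : Fin n}
    {π : Ω k × ΩR → A → ℝ} (hπ : ∀ s a, 0 ≤ π s a)
    (i : Fin n) (ωi : Ω i) (ωR : ΩR) (a : A) : 0 ≤ margIR μ0 π i ωi ωR a :=
  sum_nonneg fun ω _ => mul_nonneg (hμ0 ω) (hπ _ a)

theorem sum_margIR_messages (μ0 : ((∀ k, Ω k) × ΩR) → ℝ) {k : Fin n}
    {π : Ω k × ΩR → A → ℝ} (hπ : ∀ s, ∑ a, π s a = 1)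
    (i : Fin n) (ωi : Ω i) (ωR : ΩR) :
    ∑ a, margIR μ0 π i ωi ωR a = priorIR μ0 i ωi ωR := by
  unfold margIR priorIR jointP
  rw [sum_comm]
  exact sum_congr rfl fun ω _ => by rw [← mul_sum, hπ, mul_one]

set_option linter.unusedSectionVars false in
theorem sum_margIR_states (μ0 : ((∀ k, Ω k) × ΩR) → ℝ) {k : Fin n}
    (π : Ω k × ΩR → A → ℝ) (i : Fin n) (a : A) :
    ∑ s : Ω i × ΩR, margIR μ0 π i s.1 s.2 a = Pmsg μ0 π a := by
  unfold margIR Pmsg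
  rw [← sum_fiberwise univ (fun ω : (∀ k, Ω k) × ΩR => (ω.1 i, ω.2))]
  refine sum_congr rfl fun s _ => sum_congr (filter_congr fun ω _ => ?_) fun _ _ => rfl
  rw [Prod.ext_iff]

set_option linter.unusedSectionVars false in
theorem margIR_self (μ0 : ((∀ k, Ω k) × ΩR) → ℝ) {i : Fin n}
    (π : Ω i × ΩR → A → ℝ) (ωi : Ω i) (ωR : ΩR) (a : A) :
    margIR μ0 π i ωi ωR a = priorIR μ0 i ωi ωR * π (ωi, ωR) a := by
  unfold margIR priorIR jointP
  rw [sum_mul]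
  refine sum_congr rfl fun ω hω => ?_
  obtain ⟨h₁, h₂⟩ := (mem_filter.mp hω).2
  rw [h₁, h₂]

set_option linter.unusedSectionVars false in
theorem margIR_eq_zero {μ0 : ((∀ k, Ω k) × ΩR) → ℝ} (hμ0 : ∀ ω, 0 ≤ μ0 ω) {k : Fin n}
    (π : Ω k × ΩR → A → ℝ) {i : Fin n} {ωi : Ω i} {ωR : ΩR}
    (h : priorIR μ0 i ωi ωR = 0) (a : A) : margIR μ0 π i ωi ωR a = 0 :=
  sum_eq_zero fun ω hω => by
    rw [jointP, (sum_eq_zero_iff_of_nonneg fun ω _ => hμ0 ω).mp h ω hω, zero_mul]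

/-- Sender `i`'s simulation of `π`: the conditional distribution of the message given
`(ω_i, ω_R)`, and the distribution `π s₀` on states of prior probability zero. -/
noncomputable def simulation (μ0 : ((∀ k, Ω k) × ΩR) → ℝ) {k : Fin n}
    (π : Ω k × ΩR → A → ℝ) (s₀ : Ω k × ΩR) (i : Fin n) (s : Ω i × ΩR) (a : A) : ℝ :=
  if priorIR μ0 i s.1 s.2 = 0 then π s₀ a
  else margIR μ0 π i s.1 s.2 a / priorIR μ0 i s.1 s.2

theorem isSignal_simulation {μ0 : ((∀ k, Ω k) × ΩR) → ℝ} (hμ0 : ∀ ω, 0 ≤ μ0 ω) {k : Fin n}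
    {π : Ω k × ΩR → A → ℝ} (hπ : IsSignal π) (s₀ : Ω k × ΩR) (i : Fin n) :
    IsSignal (simulation μ0 π s₀ i) := by
  refine ⟨fun s a => ?_, fun s => ?_⟩ <;> unfold simulation <;> split_ifs with h
  · exact hπ.1 s₀ a
  · exact div_nonneg (margIR_nonneg hμ0 hπ.1 i _ _ a) (sum_nonneg fun ω _ => hμ0 ω)
  · exact hπ.2 s₀
  · rw [← sum_div, sum_margIR_messages μ0 hπ.2, div_self h]

set_option linter.unusedSectionVars false in
theorem margIR_simulation {μ0 : ((∀ k, Ω k) × ΩR) → ℝ} (hμ0 : ∀ ω, 0 ≤ μ0 ω) {k : Fin n}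
    (π : Ω k × ΩR → A → ℝ) (s₀ : Ω k × ΩR) (i : Fin n) (ωi : Ω i) (ωR : ΩR) (a : A) :
    margIR μ0 (simulation μ0 π s₀ i) i ωi ωR a = margIR μ0 π i ωi ωR a := by
  by_cases h : priorIR μ0 i ωi ωR = 0
  · rw [margIR_eq_zero hμ0 _ h, margIR_eq_zero hμ0 _ h]
  · rw [margIR_self, simulation, if_neg h, mul_div_cancel₀ _ h]

/-- Lemma 1, simulation: any other sender `i` can simulate sender `j`'s
signal `π_j` so that the induced joint distribution of `((ω_i, ω_R), a)` is unchanged;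
equivalently, all message probabilities agree and, whenever a message has positive
probability, the posteriors over `(ω_i, ω_R)` agree. -/
theorem simulation_lemma
    [Nonempty A] [Nonempty ΩR] [∀ k, Nonempty (Ω k)]
    (μ0 : ((∀ k, Ω k) × ΩR) → ℝ)
    (hμ0 : ∀ ω, 0 ≤ μ0 ω) (hμ1 : ∑ ω, μ0 ω = 1)
    (i j : Fin n) (hij : i ≠ j)
    (πj : Ω j × ΩR → A → ℝ) (hπj : IsSignal πj) :
    ∃ πi : Ω i × ΩR → A → ℝ, IsSignal πi ∧
      (∀ (ωi : Ω i) (ωR : ΩR) (a : A),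
        margIR μ0 πi i ωi ωR a = margIR μ0 πj i ωi ωR a) ∧
      (∀ a : A, Pmsg μ0 πi a = Pmsg μ0 πj a ∧
        (0 < Pmsg μ0 πj a → ∀ (ωi : Ω i) (ωR : ΩR),
          posterior μ0 πi i ωi ωR a = posterior μ0 πj i ωi ωR a)) := by
  obtain ⟨s₀⟩ : Nonempty (Ω j × ΩR) := inferInstance
  have hmarg := margIR_simulation hμ0 πj s₀ i
  have hmsg (a : A) : Pmsg μ0 (simulation μ0 πj s₀ i) a = Pmsg μ0 πj a := by
    rw [← sum_margIR_states μ0 _ i, ← sum_margIR_states μ0 πj i]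
    exact sum_congr rfl fun s _ => hmarg s.1 s.2 a
  refine ⟨simulation μ0 πj s₀ i, isSignal_simulation hμ0 hπj s₀ i, hmarg,
    fun a => ⟨hmsg a, fun _ ωi ωR => ?_⟩⟩
  rw [posterior, posterior, hmarg, hmsg]

end Persuasion
end

section
/- Posterior alignment lemma (Lemma 3 of the paper): Under Assumption 2, for every pair of senders i ≠ j, every signal π_j of sender j, every message a ∈ A with P(π_j = a) > 0, and every ω_R ∈ Ω_R with P(ω_R | π_j = a) > 0, there exists ω_i ∈ Ω_i with P(ω_i | π_j = a) > 0 such that argmax_{b∈A} u_i(b, ω_i) = argmax_{b∈A} u_R(b, ω_R). -/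
open Finset

namespace Persuasion

variable {n : ℕ} {A ΩR : Type} {Ω : Fin n → Type}
variable [Fintype A] [Fintype ΩR] [∀ k, Fintype (Ω k)]
variable [DecidableEq ΩR] [∀ k, DecidableEq (Ω k)]

/-- Lemma 3, posterior alignment: under Assumption 2, for any message `a` of
sender `j`'s signal with positive probability and any receiver state `ωR` with positive
posterior probability, there is a state `ωi` of any other sender `i` with positive posterior
probability in which `i`'s optimal actions coincide with the receiver's. -/
theorem posterior_alignment
    [Nonempty A] [Nonempty ΩR] [∀ k, Nonempty (Ω k)]
    (μ0 : ((∀ k, Ω k) × ΩR) → ℝ)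
    (hμ0 : ∀ ω, 0 ≤ μ0 ω) (hμ1 : ∑ ω, μ0 ω = 1)
    (uR : A → ΩR → ℝ) (u : ∀ k : Fin n, A → Ω k → ℝ)
    (hA2 : Assumption2 μ0 uR u)
    (i j : Fin n) (hij : i ≠ j)
    (πj : Ω j × ΩR → A → ℝ) (hπj : IsSignal πj)
    (a : A) (ha : 0 < Pmsg μ0 πj a)
    (ωR : ΩR) (hωR : 0 < margR μ0 πj ωR a) :
    ∃ ωi : Ω i, 0 < margI μ0 πj i ωi a ∧
      argmaxSet (fun b => u i b ωi) = argmaxSet (fun b => uR b ωR) := by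
  have exists_pos : ∀ (s : Finset ((∀ k, Ω k) × ΩR)) (f : (∀ k, Ω k) × ΩR → ℝ),
      0 < ∑ ω ∈ s, f ω → ∃ ω ∈ s, 0 < f ω := fun s f h => by
    by_contra! hle
    exact h.not_ge (sum_nonpos hle)
  obtain ⟨ω, hω, hpos⟩ := exists_pos _ _ hωR
  obtain rfl : ω.2 = ωR := (mem_filter.mp hω).2
  have hπ : 0 < πj (ω.1 j, ω.2) a := pos_of_mul_pos_right hpos (hμ0 ω)
  have hμ : 0 < μ0 ω := pos_of_mul_pos_left hpos hπ.le
  obtain ⟨ωi, hωi, hargmax⟩ := hA2 i j hij (ω.1 j) ω.2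
    (sum_pos' (fun ω' _ => hμ0 ω') ⟨ω, by simp, hμ⟩)
  refine ⟨ωi, ?_, hargmax⟩
  obtain ⟨ω', hω', hμ'⟩ := exists_pos _ _ hωi
  obtain ⟨hi, hj, hR⟩ := (mem_filter.mp hω').2
  refine sum_pos' (fun ω'' _ => mul_nonneg (hμ0 ω'') (hπj.1 _ _)) ⟨ω', by simp [hi], ?_⟩
  rw [jointP, hj, hR]
  exact mul_pos hμ' hπ

end Persuasion
end

section
/- Improvement lemma (Lemma 4 of the paper): Under Assumptions 1 and 2, fix a pair of senders i ≠ j and an incentive-compatible signal π_j of sender j that is not fully informative. Then there exists an incentive-compatible signal π_i of sender i such that v_R(π_i) > v_R(π_j) and v_i(π_i) > v_i(π_j). -/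
open Finset

namespace Persuasion

variable {n : ℕ} {A ΩR : Type} {Ω : Fin n → Type}
variable [Fintype A] [Fintype ΩR] [∀ k, Fintype (Ω k)]
variable [DecidableEq ΩR] [∀ k, DecidableEq (Ω k)]

lemma sum_mul_comp_eq_sum_fiber {α β : Type*} [Fintype α] [Fintype β] [DecidableEq β]
    (p : α → β) (g : α → ℝ) (f : β → ℝ) :
    ∑ ω, g ω * f (p ω) = ∑ s, (∑ ω with p ω = s, g ω) * f s := by
  rw [← Finset.sum_fiberwise univ p]
  refine sum_congr rfl fun s _ => ?_
  rw [sum_mul]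
  refine sum_congr rfl fun ω hω => ?_
  rw [(mem_filter.1 hω).2]

/-- Every nonnegative mass function whose `(ω_i, ω_R)`-marginal agrees with the prior is the
joint distribution of `((ω_i, ω_R), a)` under some signal of sender `i`. -/
lemma exists_signal_of_mass [Nonempty A] (μ0 : ((∀ k, Ω k) × ΩR) → ℝ)
    (i : Fin n) (q : Ω i × ΩR → A → ℝ) (hq : ∀ s a, 0 ≤ q s a)
    (hsum : ∀ s, ∑ a, q s a =
      ∑ ω with (fun ω : (∀ k, Ω k) × ΩR => (ω.1 i, ω.2)) ω = s, μ0 ω) :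
    ∃ π : Ω i × ΩR → A → ℝ, IsSignal π ∧ ∀ a (f : Ω i × ΩR → ℝ),
      ∑ ω, jointP μ0 π ω a * f (ω.1 i, ω.2) = ∑ s, q s a * f s := by
  classical
  have hq0 : ∀ s, ∑ a, q s a = 0 → ∀ a, q s a = 0 := fun s hs a =>
    (sum_eq_zero_iff_of_nonneg fun a _ => hq s a).1 hs a (mem_univ a)
  obtain ⟨a₀⟩ := ‹Nonempty A›
  refine ⟨fun s a => if ∑ b, q s b = 0 then (if a = a₀ then 1 else 0)
    else q s a / ∑ b, q s b, ⟨fun s a => ?_, fun s => ?_⟩, fun a f => ?_⟩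
  · dsimp only
    split_ifs
    · exact zero_le_one
    · exact le_rfl
    · exact div_nonneg (hq s a) (sum_nonneg fun b _ => hq s b)
  · by_cases hs : ∑ b, q s b = 0
    · simp [hs]
    · simp only [hs, if_false]
      rw [← sum_div, div_self hs]
  · rw [sum_mul_comp_eq_sum_fiber (fun ω : (∀ k, Ω k) × ΩR => (ω.1 i, ω.2))]
    refine sum_congr rfl fun s _ => ?_
    congr 1
    set c : ℝ := if ∑ b, q s b = 0 then (if a = a₀ then 1 else 0)
      else q s a / ∑ b, q s b with hc
    have hfib : ∑ ω with (fun ω : (∀ k, Ω k) × ΩR => (ω.1 i, ω.2)) ω = s,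
        jointP μ0 (fun s a => if ∑ b, q s b = 0 then (if a = a₀ then 1 else 0)
          else q s a / ∑ b, q s b) ω a = (∑ b, q s b) * c := by
      rw [hsum s, sum_mul]
      refine sum_congr rfl fun ω hω => ?_
      have hs : (ω.1 i, ω.2) = s := (mem_filter.1 hω).2
      rw [jointP, hs]
    rw [hfib, hc]
    by_cases hs : ∑ b, q s b = 0
    · simp [hs, hq0 s hs a]
    · rw [if_neg hs, mul_div_cancel₀ _ hs]

/-- If every realized pair `(r, a)` has positive mass on some `x` compatible with `r`, then mass
supported on compatible pairs can be removed from `q` so that, for every `(r, a)`, the same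
fraction of the total mass is removed. -/
lemma exists_proportional_mass {X R : Type*} [Fintype X] [Fintype R] [DecidableEq X]
    [Nonempty X] (q : X × R → A → ℝ) (hq : ∀ s a, 0 ≤ q s a) (good : X → R → Prop)
    (h : ∀ r a, 0 < ∑ x, q (x, r) a → ∃ x, good x r ∧ 0 < q (x, r) a) :
    ∃ ε : ℝ, 0 < ε ∧ ε ≤ 1 ∧ ∃ m : X × R → A → ℝ,
      (∀ s a, 0 ≤ m s a) ∧ (∀ s a, m s a ≤ q s a) ∧ (∀ s a, m s a ≠ 0 → good s.1 s.2) ∧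
      ∀ r a, ∑ x, m (x, r) a = ε * ∑ x, q (x, r) a := by
  have hQ : ∀ r a, 0 ≤ ∑ x, q (x, r) a := fun r a => sum_nonneg fun x _ => hq _ _
  have h' : ∀ r a, ∃ x, 0 < ∑ x, q (x, r) a → good x r ∧ 0 < q (x, r) a := fun r a => by
    by_cases hp : 0 < ∑ x, q (x, r) a
    · obtain ⟨x, hx⟩ := h r a hp
      exact ⟨x, fun _ => hx⟩
    · exact ⟨Classical.arbitrary X, fun hp' => absurd hp' hp⟩
  choose x₀ hx₀ using h'
  have hev : ∀ᶠ ε : ℝ in nhdsWithin 0 (Set.Ioi 0),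
      ∀ p : R × A, ε * ∑ x, q (x, p.1) p.2 ≤ q (x₀ p.1 p.2, p.1) p.2 := by
    rw [Filter.eventually_all]
    rintro ⟨r, a⟩
    rcases (hQ r a).eq_or_lt with h0 | hpos
    · exact Filter.Eventually.of_forall fun ε => by
        simpa [← h0] using hq (x₀ r a, r) a
    · have ht : Filter.Tendsto (fun ε : ℝ => ε * ∑ x, q (x, r) a) (nhds 0) (nhds 0) := by
        simpa using (continuous_id.mul continuous_const).tendsto (0 : ℝ)
          (f := fun ε : ℝ => ε * ∑ x, q (x, r) a)
      exact nhdsWithin_le_nhds ((ht.eventually_lt_const (hx₀ r a hpos).2).mono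
        fun _ hlt => hlt.le)
  have hone : ∀ᶠ ε : ℝ in nhdsWithin 0 (Set.Ioi 0), ε ≤ 1 :=
    nhdsWithin_le_nhds (eventually_le_nhds zero_lt_one)
  obtain ⟨ε, ⟨hε, hε1⟩, hεpos⟩ := ((hev.and hone).and self_mem_nhdsWithin).exists
  have hεpos : 0 < ε := hεpos
  refine ⟨ε, hεpos, hε1,
    fun s a => if s.1 = x₀ s.2 a then ε * ∑ x, q (x, s.2) a else 0, ?_, ?_, ?_, ?_⟩
  · intro s a
    dsimp only
    split_ifs
    · exact mul_nonneg hεpos.le (hQ _ _)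
    · exact le_rfl
  · rintro ⟨x, r⟩ a
    dsimp only
    split_ifs with hx
    · rw [hx]
      exact hε (r, a)
    · exact hq _ _
  · rintro ⟨x, r⟩ a hne
    dsimp only at hne ⊢
    split_ifs at hne with hx
    · rw [hx]
      exact (hx₀ r a (lt_of_le_of_ne (hQ r a) (Ne.symm (right_ne_zero_of_mul hne)))).1
    · exact absurd rfl hne
  · intro r a
    simp

/-- The mass obtained from `q` by moving the mass `m s b` of each message `b` to the message
`t s`. -/
noncomputable def moveMass {S : Type*} [DecidableEq A] (q m : S → A → ℝ) (t : S → A)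
    (s : S) (a : A) : ℝ :=
  q s a - m s a + if a = t s then ∑ b, m s b else 0

lemma sum_moveMass_mul {S : Type*} [DecidableEq A] (q m : S → A → ℝ) (t : S → A)
    (s : S) (f : A → ℝ) :
    ∑ a, moveMass q m t s a * f a =
      ∑ a, q s a * f a + ∑ a, m s a * (f (t s) - f a) := by
  simp only [moveMass, add_mul, sub_mul, mul_sub, sum_add_distrib, sum_sub_distrib, ite_mul,
    zero_mul, sum_ite_eq', mem_univ, if_true, sum_mul]
  ring

lemma sum_lt_sum_moveMass {S : Type*} [Fintype S] [DecidableEq A] (q m : S → A → ℝ)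
    (t : S → A) (f : A → S → ℝ) (hm : ∀ s a, 0 ≤ m s a)
    (hle : ∀ s a, m s a ≠ 0 → f a s ≤ f (t s) s)
    (hlt : ∃ s a, m s a ≠ 0 ∧ f a s < f (t s) s) :
    ∑ a, ∑ s, q s a * f a s < ∑ a, ∑ s, moveMass q m t s a * f a s := by
  have hterm : ∀ s a, 0 ≤ m s a * (f (t s) s - f a s) := fun s a => by
    by_cases h0 : m s a = 0
    · simp [h0]
    · exact mul_nonneg (hm s a) (sub_nonneg.2 (hle s a h0))
  rw [sum_comm, sum_comm (f := fun a s => moveMass q m t s a * f a s)]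
  have hsum : ∑ s, ∑ a, moveMass q m t s a * f a s =
      ∑ s, ∑ a, q s a * f a s + ∑ s, ∑ a, m s a * (f (t s) s - f a s) := by
    rw [← sum_add_distrib]
    exact sum_congr rfl fun s _ => sum_moveMass_mul q m t s fun a => f a s
  rw [hsum]
  refine lt_add_of_pos_right _ ?_
  obtain ⟨s, a, hne, hfa⟩ := hlt
  exact sum_pos' (fun s _ => sum_nonneg fun a _ => hterm s a) ⟨s, mem_univ s,
    sum_pos' (fun a _ => hterm s a) ⟨a, mem_univ a,
      mul_pos (lt_of_le_of_ne (hm s a) hne.symm) (sub_pos.2 hfa)⟩⟩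

/-- Removing the same fraction of mass for every `(r, a)` and reassigning it to the optimal
actions preserves obedience. -/
lemma obedient_moveMass {X R : Type*} [Fintype X] [Fintype R] [DecidableEq A]
    (q m : X × R → A → ℝ) (t : R → A) (uR : A → R → ℝ) (ε : ℝ) (hε : ε ≤ 1)
    (hm : ∀ s a, 0 ≤ m s a)
    (hprop : ∀ r a, ∑ x, m (x, r) a = ε * ∑ x, q (x, r) a)
    (ht : ∀ r b, uR b r ≤ uR (t r) r) (a b : A)
    (hq : ∑ s, q s a * uR b s.2 ≤ ∑ s, q s a * uR a s.2) :
    ∑ s, moveMass q m (fun s => t s.2) s a * uR b s.2 ≤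
      ∑ s, moveMass q m (fun s => t s.2) s a * uR a s.2 := by
  have hmsum : ∀ c, ∑ s, m s a * uR c s.2 = ε * ∑ s, q s a * uR c s.2 := fun c => by
    rw [Fintype.sum_prod_type_right, Fintype.sum_prod_type_right, mul_sum]
    refine sum_congr rfl fun r _ => ?_
    dsimp only
    rw [← sum_mul, ← sum_mul, hprop, mul_assoc]
  have hadd : ∑ s : X × R, (if a = t s.2 then ∑ c, m s c else 0) * uR b s.2 ≤
      ∑ s : X × R, (if a = t s.2 then ∑ c, m s c else 0) * uR a s.2 := by
    refine sum_le_sum fun s _ => ?_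
    split_ifs with has
    · rw [has]
      exact mul_le_mul_of_nonneg_left (ht _ _) (sum_nonneg fun c _ => hm s c)
    · simp
  simp only [moveMass, add_mul, sub_mul, sum_add_distrib, sum_sub_distrib, hmsum]
  nlinarith [mul_le_mul_of_nonneg_left hq (sub_nonneg.2 hε)]

lemma jointP_nonneg {μ0 : ((∀ k, Ω k) × ΩR) → ℝ} (hμ0 : ∀ ω, 0 ≤ μ0 ω) {k : Fin n}
    {π : Ω k × ΩR → A → ℝ} (hπ : IsSignal π) (ω : (∀ k, Ω k) × ΩR) (a : A) :
    0 ≤ jointP μ0 π ω a :=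
  mul_nonneg (hμ0 ω) (hπ.1 _ _)

/-- Incentive compatibility in terms of unnormalized expected utilities. -/
lemma ic_iff {μ0 : ((∀ k, Ω k) × ΩR) → ℝ} (hμ0 : ∀ ω, 0 ≤ μ0 ω) {k : Fin n}
    {π : Ω k × ΩR → A → ℝ} (hπ : IsSignal π) (uR : A → ΩR → ℝ) :
    IC μ0 π uR ↔ ∀ a b, ∑ ω, jointP μ0 π ω a * uR b ω.2 ≤
      ∑ ω, jointP μ0 π ω a * uR a ω.2 := by
  refine ⟨fun h a b => ?_, fun h a _ b => ?_⟩
  · have hP : 0 ≤ Pmsg μ0 π a := sum_nonneg fun ω _ => jointP_nonneg hμ0 hπ ω a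
    rcases hP.eq_or_lt with h0 | hpos
    · have hz : ∀ ω, jointP μ0 π ω a = 0 := fun ω =>
        (sum_eq_zero_iff_of_nonneg fun ω _ => jointP_nonneg hμ0 hπ ω a).1 h0.symm ω
          (mem_univ ω)
      simp [hz]
    · exact (div_le_div_iff_of_pos_right hpos).1 (h a hpos b)
  · exact div_le_div_of_nonneg_right (h a b) (sum_nonneg fun ω _ => jointP_nonneg hμ0 hπ ω a)

/-- Under Assumption 2, whenever the message `a` is realized jointly with `ω_R` under a signal of
sender `j`, it is also realized jointly with `ω_R` and some aligned state of sender `i`. -/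
lemma exists_aligned_state {μ0 : ((∀ k, Ω k) × ΩR) → ℝ} (hμ0 : ∀ ω, 0 ≤ μ0 ω)
    {uR : A → ΩR → ℝ} {u : ∀ k : Fin n, A → Ω k → ℝ} (hA2 : Assumption2 μ0 uR u)
    {i j : Fin n} (hij : i ≠ j) {πj : Ω j × ΩR → A → ℝ} (hπj : IsSignal πj)
    {ω₀ : (∀ k, Ω k) × ΩR} {a : A} (hpos : 0 < jointP μ0 πj ω₀ a) :
    ∃ ω : (∀ k, Ω k) × ΩR, ω.2 = ω₀.2 ∧ 0 < jointP μ0 πj ω a ∧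
      argmaxSet (fun b => u i b (ω.1 i)) = argmaxSet (fun b => uR b ω₀.2) := by
  have hμpos : 0 < μ0 ω₀ := pos_of_mul_pos_left hpos (hπj.1 _ _)
  have hπpos : 0 < πj (ω₀.1 j, ω₀.2) a := pos_of_mul_pos_right hpos (hμ0 ω₀)
  obtain ⟨x, hx, hal⟩ := hA2 i j hij (ω₀.1 j) ω₀.2
    (sum_pos' (fun ω _ => hμ0 ω) ⟨ω₀, by simp, hμpos⟩)
  obtain ⟨ω, hω, hωpos⟩ := exists_lt_of_sum_lt (s := univ.filter
    (fun ω : (∀ k, Ω k) × ΩR => ω.1 i = x ∧ ω.1 j = ω₀.1 j ∧ ω.2 = ω₀.2))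
    (f := fun _ => (0 : ℝ)) (g := μ0) (by simpa using hx)
  obtain ⟨hi, hj, hR⟩ := (mem_filter.1 hω).2
  refine ⟨ω, hR, ?_, by rw [hi]; exact hal⟩
  rw [jointP, hj, hR]
  exact mul_pos hωpos hπpos

/-- Lemma 4, improvement: under Assumptions 1 and 2, if sender `j`'s
incentive-compatible signal `π_j` is not fully informative, then any other sender `i` has an
incentive-compatible signal `π_i` that both the receiver and sender `i` strictly prefer. -/
theorem improvement_lemma
    [Nonempty A] [Nonempty ΩR] [∀ k, Nonempty (Ω k)]
    (μ0 : ((∀ k, Ω k) × ΩR) → ℝ)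
    (hμ0 : ∀ ω, 0 ≤ μ0 ω) (hμ1 : ∑ ω, μ0 ω = 1)
    (uR : A → ΩR → ℝ) (u : ∀ k : Fin n, A → Ω k → ℝ)
    (hA1 : Assumption1 uR u) (hA2 : Assumption2 μ0 uR u)
    (i j : Fin n) (hij : i ≠ j)
    (πj : Ω j × ΩR → A → ℝ) (hπj : IsSignal πj) (hICj : IC μ0 πj uR)
    (hnotFI : ¬ FullyInformative μ0 πj uR) :
    ∃ πi : Ω i × ΩR → A → ℝ, IsSignal πi ∧ IC μ0 πi uR ∧
      vR μ0 πj uR < vR μ0 πi uR ∧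
      vS μ0 πj i (u i) < vS μ0 πi i (u i) := by
  classical
  choose t ht using fun r => card_eq_one.1 (hA1.1 r)
  have hmax : ∀ {v : A → ℝ} {c : A}, argmaxSet v = {c} → ∀ b, v b ≤ v c := fun {v c} h => by
    have hc : c ∈ argmaxSet v := by rw [h]; exact mem_singleton_self c
    exact (mem_filter.1 hc).2
  have hstrict : ∀ {v : A → ℝ} {c : A}, argmaxSet v = {c} → ∀ b, b ≠ c → v b < v c :=
    fun {v c} h b hb => lt_of_not_ge fun hcb => hb <| mem_singleton.1 <| by
      rw [← h]
      exact mem_filter.2 ⟨mem_univ b, fun d => (hmax h d).trans hcb⟩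
  set p : (∀ k, Ω k) × ΩR → Ω i × ΩR := fun ω => (ω.1 i, ω.2) with hp
  set q : Ω i × ΩR → A → ℝ := fun s a => ∑ ω with p ω = s, jointP μ0 πj ω a with hqdef
  have hJ := fun ω a => jointP_nonneg hμ0 hπj ω a
  have hq : ∀ s a, 0 ≤ q s a := fun s a => sum_nonneg fun ω _ => hJ ω a
  have hqsum : ∀ a (f : Ω i × ΩR → ℝ),
      ∑ ω, jointP μ0 πj ω a * f (p ω) = ∑ s, q s a * f s := fun a f =>
    sum_mul_comp_eq_sum_fiber p (fun ω => jointP μ0 πj ω a) f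
  have hqpos : ∀ ω a, 0 < jointP μ0 πj ω a → 0 < q (p ω) a := fun ω a hω =>
    sum_pos' (fun ω _ => hJ ω a) ⟨ω, by simp, hω⟩
  obtain ⟨ε, hε0, hε1, m, hm0, hmq, hmgood, hmprop⟩ := exists_proportional_mass q hq
    (fun x r => argmaxSet (fun b => u i b x) = {t r}) (fun r a hpos => by
      obtain ⟨x, -, hx⟩ := exists_lt_of_sum_lt (s := univ) (f := fun _ => (0 : ℝ))
        (g := fun x => q (x, r) a) (by simpa using hpos)
      obtain ⟨ω₀, hω₀, hpos₀⟩ := exists_lt_of_sum_lt (f := fun _ => (0 : ℝ))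
        (g := fun ω => jointP μ0 πj ω a) (s := univ.filter fun ω => p ω = (x, r))
        (by simpa using hx)
      have hr : ω₀.2 = r := congrArg Prod.snd (mem_filter.1 hω₀).2
      obtain ⟨ω, hωR, hωpos, hal⟩ := exists_aligned_state hμ0 hA2 hij hπj hpos₀
      refine ⟨ω.1 i, by rw [hal, hr, ht], ?_⟩
      rw [← hωR.trans hr]
      exact hqpos ω a hωpos)
  have hq'0 : ∀ s a, 0 ≤ moveMass q m (fun s => t s.2) s a := fun s a => by
    unfold moveMass
    refine add_nonneg (sub_nonneg.2 (hmq s a)) ?_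
    split_ifs
    · exact sum_nonneg fun b _ => hm0 s b
    · exact le_rfl
  obtain ⟨πi, hπi, hπisum⟩ := exists_signal_of_mass μ0 i
    (moveMass q m fun s => t s.2) hq'0 (fun s => by
      have h := sum_moveMass_mul q m (fun s => t s.2) s fun _ => 1
      simp only [mul_one, sub_self, mul_zero, sum_const_zero, add_zero] at h
      rw [h, hqdef, sum_comm]
      refine sum_congr rfl fun ω _ => ?_
      simp only [jointP]
      rw [← mul_sum, hπj.2, mul_one])
  have hwit : ∃ s a, m s a ≠ 0 ∧ a ≠ t s.2 := by
    simp only [FullyInformative, not_forall] at hnotFI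
    obtain ⟨a, r, hpos, hne⟩ := hnotFI
    obtain ⟨ω, hω, hωpos⟩ := exists_lt_of_sum_lt (s := univ.filter _)
      (f := fun _ => (0 : ℝ)) (g := fun ω => jointP μ0 πj ω a)
      (by simpa [margR] using hpos)
    have hr : ω.2 = r := (mem_filter.1 hω).2
    have hQ : 0 < ∑ x, m (x, r) a := by
      rw [hmprop]
      refine mul_pos hε0 (sum_pos' (fun x _ => hq _ _) ⟨ω.1 i, mem_univ _, ?_⟩)
      rw [← hr]
      exact hqpos ω a hωpos
    obtain ⟨x, -, hx⟩ := exists_ne_zero_of_sum_ne_zero hQ.ne'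
    refine ⟨(x, r), a, hx, fun hat => hne ?_⟩
    rw [ht, hat]
  obtain ⟨s, a, hsa, hne⟩ := hwit
  refine ⟨πi, hπi, (ic_iff hμ0 hπi uR).2 fun a b => ?_, ?_, ?_⟩
  · have hICq := (ic_iff hμ0 hπj uR).1 hICj a b
    rw [hqsum a fun s => uR b s.2, hqsum a fun s => uR a s.2] at hICq
    rw [hπisum a fun s => uR b s.2, hπisum a fun s => uR a s.2]
    exact obedient_moveMass q m t uR ε hε1 hm0 hmprop (fun r => hmax (ht r)) a b hICq
  · unfold vR
    rw [sum_congr rfl fun a _ => hqsum a fun s => uR a s.2,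
      sum_congr rfl fun a _ => hπisum a fun s => uR a s.2]
    exact sum_lt_sum_moveMass q m _ (fun a s => uR a s.2) hm0
      (fun s a _ => hmax (ht s.2) a) ⟨s, a, hsa, hstrict (ht s.2) a hne⟩
  · unfold vS
    rw [sum_congr rfl fun a _ => hqsum a fun s => u i a s.1,
      sum_congr rfl fun a _ => hπisum a fun s => u i a s.1]
    exact sum_lt_sum_moveMass q m _ (fun a s => u i a s.1) hm0
      (fun s a h => hmax (hmgood s a h) a) ⟨s, a, hsa, hstrict (hmgood s a hsa) a hne⟩

end Persuasion
end

section
/- Main theorem, pure-strategy case: Suppose n ≥ 2 and Assumptions 1 and 2 hold. In every pure Nash equilibrium (π_1,…,π_n) of the persuasion game with the uniform tie-breaking decision rule, every signal π_j with j ∈ argmax_k v_R(π_k) (i.e., every signal chosen by the receiver with positive probability) is fully informative. -/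
open Finset

namespace Persuasion

variable {n : ℕ} {A ΩR : Type} {Ω : Fin n → Type}
variable [Fintype A] [Fintype ΩR] [∀ k, Fintype (Ω k)]
variable [DecidableEq ΩR] [∀ k, DecidableEq (Ω k)]

set_option linter.unusedSectionVars false

/-- Incentive compatibility in unnormalized form. -/
lemma IC_iff {μ0 : ((∀ k, Ω k) × ΩR) → ℝ} (hμ0 : ∀ ω, 0 ≤ μ0 ω) {uR : A → ΩR → ℝ}
    {i : Fin n} {σ : Ω i × ΩR → A → ℝ} (hσ : IsSignal σ) :
    IC μ0 σ uR ↔ ∀ a b, ∑ ω, jointP μ0 σ ω a * (uR b ω.2 - uR a ω.2) ≤ 0 := by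
  have hnn : ∀ ω a, 0 ≤ jointP μ0 σ ω a := fun ω a => mul_nonneg (hμ0 ω) (hσ.1 _ a)
  constructor
  · intro h a b
    simp only [mul_sub, sum_sub_distrib, sub_nonpos]
    rcases (sum_nonneg fun ω _ => hnn ω a : 0 ≤ Pmsg μ0 σ a).eq_or_lt with h0 | h0
    · have hz := (sum_eq_zero_iff_of_nonneg fun ω _ => hnn ω a).1 h0.symm
      rw [sum_eq_zero fun ω hω => by rw [hz ω hω, zero_mul],
        sum_eq_zero fun ω hω => by rw [hz ω hω, zero_mul]]
    · exact (div_le_div_iff_of_pos_right h0).1 (h a h0 b)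
  · intro h a ha b
    have := h a b
    simp only [mul_sub, sum_sub_distrib, sub_nonpos] at this
    exact (div_le_div_iff_of_pos_right ha).2 this

/-- Sender `i` can reproduce the joint law of `(ω_i, ω_R)` and the message under any
signal `π` of another sender. -/
lemma exists_copy {μ0 : ((∀ k, Ω k) × ΩR) → ℝ} (hμ0 : ∀ ω, 0 ≤ μ0 ω)
    {j : Fin n} [Nonempty (Ω j)] (i : Fin n) {π : Ω j × ΩR → A → ℝ} (hπ : IsSignal π) :
    ∃ σ : Ω i × ΩR → A → ℝ, IsSignal σ ∧ ∀ a (F : Ω i × ΩR → ℝ),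
      ∑ ω, jointP μ0 σ ω a * F (ω.1 i, ω.2) = ∑ ω, jointP μ0 π ω a * F (ω.1 i, ω.2) := by
  classical
  let fib : Ω i × ΩR → Finset ((∀ k, Ω k) × ΩR) := fun s => {ω | (ω.1 i, ω.2) = s}
  let m : Ω i × ΩR → ℝ := fun s => ∑ ω ∈ fib s, μ0 ω
  have hnn : ∀ ω a, 0 ≤ jointP μ0 π ω a := fun ω a => mul_nonneg (hμ0 ω) (hπ.1 _ a)
  have hm : ∀ s, 0 ≤ m s := fun s => sum_nonneg fun ω _ => hμ0 ω
  refine ⟨fun s a => if m s = 0 then π (Classical.arbitrary _, s.2) a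
    else (∑ ω ∈ fib s, jointP μ0 π ω a) / m s, ⟨fun s a => ?_, fun s => ?_⟩, fun a F => ?_⟩
  · dsimp only
    split_ifs
    · exact hπ.1 _ a
    · exact div_nonneg (sum_nonneg fun ω _ => hnn ω a) (hm s)
  · dsimp only
    split_ifs with h
    · exact hπ.2 _
    · rw [← sum_div, sum_comm, div_eq_one_iff_eq h]
      simp only [jointP, ← mul_sum, hπ.2, mul_one, m]
  · rw [← sum_fiberwise univ (fun ω : (∀ k, Ω k) × ΩR => (ω.1 i, ω.2)),
      ← sum_fiberwise univ (fun ω : (∀ k, Ω k) × ΩR => (ω.1 i, ω.2))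
        (fun ω => jointP μ0 π ω a * F (ω.1 i, ω.2))]
    refine sum_congr rfl fun s _ => ?_
    have hr : ∑ ω ∈ univ with (ω.1 i, ω.2) = s, jointP μ0 π ω a * F (ω.1 i, ω.2)
        = (∑ ω ∈ fib s, jointP μ0 π ω a) * F s := by
      rw [sum_mul]
      exact sum_congr rfl fun ω hω => by rw [(mem_filter.1 hω).2]
    rw [hr]
    have hl : ∀ x : ℝ, ∑ ω ∈ fib s, μ0 ω * x * F s = m s * x * F s := fun x => by
      simp only [m, sum_mul]
    refine (sum_congr rfl fun ω hω => ?_).trans ((hl (if m s = 0 then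
      π (Classical.arbitrary _, s.2) a else (∑ ω ∈ fib s, jointP μ0 π ω a) / m s)).trans ?_)
    · obtain rfl := (mem_filter.1 hω).2
      rfl
    · split_ifs with h
      · have hz := (sum_eq_zero_iff_of_nonneg fun ω _ => hμ0 ω).1 h
        rw [h, sum_eq_zero fun ω hω => by rw [jointP, hz ω hω, zero_mul]]
        simp
      · rw [mul_div_cancel₀ _ h]

open Classical in
/-- The signal obtained from `σ` by replacing the mass `τ` with recommendations of `best`. -/
noncomputable def reveal {i : Fin n} (best : ΩR → A) (σ τ : Ω i × ΩR → A → ℝ) :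
    Ω i × ΩR → A → ℝ :=
  fun s a => σ s a - τ s a + if a = best s.2 then ∑ b, τ s b else 0

lemma isSignal_reveal {i : Fin n} (best : ΩR → A) {σ τ : Ω i × ΩR → A → ℝ}
    (hσ : IsSignal σ) (h0 : ∀ s a, 0 ≤ τ s a) (h1 : ∀ s a, τ s a ≤ σ s a) :
    IsSignal (reveal best σ τ) := by
  classical
  refine ⟨fun s a => ?_, fun s => ?_⟩
  · refine add_nonneg (sub_nonneg.2 (h1 s a)) ?_
    split_ifs
    · exact sum_nonneg fun b _ => h0 s b
    · exact le_rfl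
  · simp [reveal, sum_add_distrib, hσ.2 s]

lemma sum_reveal (μ0 : ((∀ k, Ω k) × ΩR) → ℝ) {i : Fin n} (best : ΩR → A)
    (σ τ : Ω i × ΩR → A → ℝ) (F : A → ((∀ k, Ω k) × ΩR) → ℝ) :
    ∑ a, ∑ ω, jointP μ0 (reveal best σ τ) ω a * F a ω
      = ∑ a, ∑ ω, jointP μ0 σ ω a * F a ω
        + ∑ a, ∑ ω, jointP μ0 τ ω a * (F (best ω.2) ω - F a ω) := by
  classical
  rw [sum_comm, sum_comm (s := univ) (t := univ) (f := fun a ω => jointP μ0 σ ω a * F a ω),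
    sum_comm (s := univ) (t := univ)
      (f := fun a ω => jointP μ0 τ ω a * (F (best ω.2) ω - F a ω)), ← sum_add_distrib]
  refine sum_congr rfl fun ω _ => ?_
  have : ∀ a, jointP μ0 (reveal best σ τ) ω a * F a ω
      = jointP μ0 σ ω a * F a ω - jointP μ0 τ ω a * F a ω
        + if a = best ω.2 then (∑ b, jointP μ0 τ ω b) * F (best ω.2) ω else 0 := by
    intro a
    simp only [jointP, reveal, ← mul_sum]
    split_ifs with h
    · subst h; ring
    · ring
  simp only [this, sum_add_distrib, sum_sub_distrib, mul_sub, sum_ite_eq', mem_univ, if_true,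
    sum_mul]
  ring

/-- Revealing a mass `τ` that does not change the receiver's posteriors preserves incentive
compatibility. -/
lemma IC_reveal {μ0 : ((∀ k, Ω k) × ΩR) → ℝ} (hμ0 : ∀ ω, 0 ≤ μ0 ω) {uR : A → ΩR → ℝ}
    {best : ΩR → A} (hbest : ∀ ωR b, uR b ωR ≤ uR (best ωR) ωR)
    {i : Fin n} {σ τ : Ω i × ΩR → A → ℝ}
    (hσ : IsSignal σ) (hIC : IC μ0 σ uR) (h0 : ∀ s a, 0 ≤ τ s a) (h1 : ∀ s a, τ s a ≤ σ s a)
    {ε : ℝ} (hε : ε ≤ 1)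
    (hτ : ∀ a (h : ΩR → ℝ), ∑ ω, jointP μ0 τ ω a * h ω.2 = ε * ∑ ω, jointP μ0 σ ω a * h ω.2) :
    IC μ0 (reveal best σ τ) uR := by
  classical
  rw [IC_iff hμ0 (isSignal_reveal best hσ h0 h1)]
  rw [IC_iff hμ0 hσ] at hIC
  intro a b
  have hle : ∀ ω ∈ univ, jointP μ0 (reveal best σ τ) ω a * (uR b ω.2 - uR a ω.2)
      ≤ jointP μ0 σ ω a * (uR b ω.2 - uR a ω.2) - jointP μ0 τ ω a * (uR b ω.2 - uR a ω.2) := by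
    intro ω _
    have : (if a = best ω.2 then ∑ b, τ (ω.1 i, ω.2) b else 0) * (uR b ω.2 - uR a ω.2) ≤ 0 := by
      split_ifs with h
      · rw [h]
        exact mul_nonpos_of_nonneg_of_nonpos (sum_nonneg fun b _ => h0 _ b)
          (sub_nonpos.2 (hbest _ _))
      · simp
    have := mul_nonpos_of_nonneg_of_nonpos (hμ0 ω) this
    simp only [jointP, reveal]
    linarith
  refine (sum_le_sum hle).trans ?_
  rw [sum_sub_distrib, hτ a (fun ωR => uR b ωR - uR a ωR)]
  have := hIC a b
  nlinarith

/-- The receiver strictly gains from revealing part of a signal that is not fully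
informative. -/
lemma vR_lt_vR_reveal {μ0 : ((∀ k, Ω k) × ΩR) → ℝ} {uR : A → ΩR → ℝ}
    {best : ΩR → A} {i : Fin n} {σ τ : Ω i × ΩR → A → ℝ} {ε : ℝ} (hε : 0 < ε)
    (hτ : ∀ a (h : ΩR → ℝ), ∑ ω, jointP μ0 τ ω a * h ω.2 = ε * ∑ ω, jointP μ0 σ ω a * h ω.2)
    (hlt : vR μ0 σ uR < ∑ a, ∑ ω, jointP μ0 σ ω a * uR (best ω.2) ω.2) :
    vR μ0 σ uR < vR μ0 (reveal best σ τ) uR := by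
  rw [vR, vR, sum_reveal μ0 best σ τ (fun a ω => uR a ω.2)]
  have hgain : ∑ a, ∑ ω, jointP μ0 τ ω a * (uR (best ω.2) ω.2 - uR a ω.2)
      = ε * (∑ a, ∑ ω, jointP μ0 σ ω a * uR (best ω.2) ω.2 - vR μ0 σ uR) := by
    rw [vR, ← sum_sub_distrib, mul_sum]
    refine sum_congr rfl fun a _ => ?_
    rw [hτ a (fun ωR => uR (best ωR) ωR - uR a ωR)]
    simp only [mul_sub, sum_sub_distrib]
  rw [hgain]
  exact lt_add_of_pos_right _ (mul_pos hε (sub_pos.2 hlt))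

/-- A signal that is not fully informative recommends a suboptimal action with positive
probability. -/
lemma exists_of_not_fullyInformative {μ0 : ((∀ k, Ω k) × ΩR) → ℝ} {uR : A → ΩR → ℝ}
    {best : ΩR → A} (hbest : ∀ ωR, argmaxSet (fun a => uR a ωR) = {best ωR})
    {j : Fin n} {π : Ω j × ΩR → A → ℝ}
    (h : ¬ FullyInformative μ0 π uR) :
    ∃ a ω, 0 < jointP μ0 π ω a ∧ a ≠ best ω.2 := by
  simp only [FullyInformative, not_forall] at h
  obtain ⟨a, ωR, hpos, hne⟩ := h
  obtain ⟨ω, hω, hp⟩ := exists_lt_of_sum_lt (s := univ.filter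
    (fun ω : (∀ k, Ω k) × ΩR => ω.2 = ωR)) (f := fun _ => (0 : ℝ)) (by simpa [margR] using hpos)
  refine ⟨a, ω, hp, fun he => hne ?_⟩
  rw [hbest, he, (mem_filter.1 hω).2]

lemma lt_of_argmaxSet_eq_singleton {f : A → ℝ} {a b : A} (h : argmaxSet f = {a}) (hb : b ≠ a) :
    f b < f a := by
  have ha : ∀ c, f c ≤ f a := by
    have : a ∈ argmaxSet f := by simp [h]
    simpa [argmaxSet] using this
  refine lt_of_not_ge fun hle => hb ?_
  have : b ∈ argmaxSet f := by simpa [argmaxSet] using fun c => (ha c).trans hle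
  simpa [h] using this

lemma le_of_argmaxSet_eq_singleton {f : A → ℝ} {a : A} (h : argmaxSet f = {a}) (b : A) :
    f b ≤ f a := by
  rcases eq_or_ne b a with rfl | hb
  · exact le_rfl
  · exact (lt_of_argmaxSet_eq_singleton h hb).le

/-- A signal misrecommending with positive probability leaves the receiver below the
first best. -/
lemma vR_lt_first_best {μ0 : ((∀ k, Ω k) × ΩR) → ℝ} (hμ0 : ∀ ω, 0 ≤ μ0 ω) {uR : A → ΩR → ℝ}
    {best : ΩR → A} (hbest : ∀ ωR, argmaxSet (fun a => uR a ωR) = {best ωR})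
    {j : Fin n} {π : Ω j × ΩR → A → ℝ} (hπ : IsSignal π)
    (h : ∃ a ω, 0 < jointP μ0 π ω a ∧ a ≠ best ω.2) :
    vR μ0 π uR < ∑ a, ∑ ω, jointP μ0 π ω a * uR (best ω.2) ω.2 := by
  obtain ⟨a, ω, hpos, hne⟩ := h
  have hle : ∀ a ω, jointP μ0 π ω a * uR a ω.2 ≤ jointP μ0 π ω a * uR (best ω.2) ω.2 :=
    fun a ω => mul_le_mul_of_nonneg_left (le_of_argmaxSet_eq_singleton (hbest ω.2) a)
      (mul_nonneg (hμ0 ω) (hπ.1 _ a))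
  exact sum_lt_sum (fun a _ => sum_le_sum fun ω _ => hle a ω)
    ⟨a, mem_univ _, sum_lt_sum (fun ω _ => hle a ω)
      ⟨ω, mem_univ _, mul_lt_mul_of_pos_left
        (lt_of_argmaxSet_eq_singleton (hbest ω.2) hne) hpos⟩⟩

/-- The expectation of a function of the state does not depend on the signal. -/
lemma sum_jointP_mul (μ0 : ((∀ k, Ω k) × ΩR) → ℝ) {j : Fin n} {π : Ω j × ΩR → A → ℝ}
    (hπ : IsSignal π) (h : ((∀ k, Ω k) × ΩR) → ℝ) :
    ∑ a, ∑ ω, jointP μ0 π ω a * h ω = ∑ ω, μ0 ω * h ω := by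
  rw [sum_comm]
  exact sum_congr rfl fun ω _ => by
    rw [← sum_mul]; simp only [jointP, ← mul_sum, hπ.2, mul_one]

/-- A sender `i ≠ j` can strictly improve on a signal of `j` that is not fully informative,
both for the receiver and for himself. -/
lemma exists_improvement {μ0 : ((∀ k, Ω k) × ΩR) → ℝ} (hμ0 : ∀ ω, 0 ≤ μ0 ω)
    {uR : A → ΩR → ℝ} {u : ∀ k : Fin n, A → Ω k → ℝ} (hA2 : Assumption2 μ0 uR u)
    {best : ΩR → A} (hbest : ∀ ωR, argmaxSet (fun a => uR a ωR) = {best ωR})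
    {i j : Fin n} (hij : i ≠ j) [Nonempty (Ω j)] {π : Ω j × ΩR → A → ℝ}
    (hπ : IsSignal π) (hIC : IC μ0 π uR) (h : ∃ a ω, 0 < jointP μ0 π ω a ∧ a ≠ best ω.2) :
    ∃ π' : Ω i × ΩR → A → ℝ, IsSignal π' ∧ IC μ0 π' uR ∧ vR μ0 π uR < vR μ0 π' uR ∧
      vS μ0 π i (u i) < vS μ0 π' i (u i) := by
  classical
  obtain ⟨σ, hσ, hcopy⟩ := exists_copy hμ0 i hπ
  have hσ0 : ∀ ω a, 0 ≤ jointP μ0 σ ω a := fun ω a => mul_nonneg (hμ0 ω) (hσ.1 _ a)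
  have hσIC : IC μ0 σ uR := by
    rw [IC_iff hμ0 hσ]
    rw [IC_iff hμ0 hπ] at hIC
    intro a b
    rw [hcopy a (fun s => uR b s.2 - uR a s.2)]
    exact hIC a b
  have hσR : vR μ0 σ uR = vR μ0 π uR := sum_congr rfl fun a _ => hcopy a (fun s => uR a s.2)
  have hσS : vS μ0 σ i (u i) = vS μ0 π i (u i) :=
    sum_congr rfl fun a _ => hcopy a (fun s => u i a s.1)
  -- `aligned s`: in state `s` sender `i` and the receiver have the same optimal action.
  let aligned : Ω i × ΩR → Prop := fun s => argmaxSet (fun a => u i a s.1) = {best s.2}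
  let p : ΩR → A → ℝ := fun ωR a =>
    ∑ ω, jointP μ0 σ ω a * if ω.2 = ωR then 1 else 0
  let q : ΩR → A → ℝ := fun ωR a =>
    ∑ ω, jointP μ0 σ ω a * if aligned (ω.1 i, ω.2) ∧ ω.2 = ωR then 1 else 0
  have hp0 : ∀ ωR a, 0 ≤ p ωR a := fun ωR a =>
    sum_nonneg fun ω _ => mul_nonneg (hσ0 ω a) (by split_ifs <;> norm_num)
  have hq0 : ∀ ωR a, 0 ≤ q ωR a := fun ωR a =>
    sum_nonneg fun ω _ => mul_nonneg (hσ0 ω a) (by split_ifs <;> norm_num)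
  have hpq : ∀ ωR a, 0 < p ωR a → 0 < q ωR a := by
    intro ωR a hp
    have hp' : 0 < ∑ ω, jointP μ0 π ω a * if ω.2 = ωR then 1 else 0 :=
      (hcopy a (fun s => if s.2 = ωR then 1 else 0)) ▸ hp
    have hq' : q ωR a = ∑ ω, jointP μ0 π ω a * if aligned (ω.1 i, ω.2) ∧ ω.2 = ωR then 1 else 0 :=
      hcopy a (fun s => if aligned s ∧ s.2 = ωR then 1 else 0)
    obtain ⟨ω, -, hω⟩ := exists_lt_of_sum_lt (s := univ) (f := fun _ => (0 : ℝ))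
      (by simpa using hp')
    have hωR : ω.2 = ωR := by
      by_contra hc
      simp [hc] at hω
    have hωpos : 0 < μ0 ω * π (ω.1 j, ωR) a := by simpa [hωR, jointP] using hω
    have hμω : 0 < μ0 ω := pos_of_mul_pos_left hωpos (hπ.1 _ a)
    have hπω : 0 < π (ω.1 j, ωR) a := pos_of_mul_pos_right hωpos (hμ0 ω)
    obtain ⟨ωi, hmass, harg⟩ := hA2 i j hij (ω.1 j) ωR
      (sum_pos' (fun ω _ => hμ0 ω) ⟨ω, by simp [hωR], hμω⟩)
    obtain ⟨ω', hω', hμω'⟩ := exists_lt_of_sum_lt (s := univ.filter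
      (fun ω' : (∀ k, Ω k) × ΩR => ω'.1 i = ωi ∧ ω'.1 j = ω.1 j ∧ ω'.2 = ωR))
      (f := fun _ => (0 : ℝ)) (by simpa using hmass)
    obtain ⟨hi', hj', hR'⟩ := (mem_filter.1 hω').2
    have hal : aligned (ω'.1 i, ω'.2) := by
      simp only [aligned, hi', hR', harg, hbest]
    rw [hq']
    refine sum_pos' (fun ω _ => mul_nonneg (mul_nonneg (hμ0 ω) (hπ.1 _ a))
      (by split_ifs <;> norm_num)) ⟨ω', mem_univ _, ?_⟩
    rw [if_pos ⟨hal, hR'⟩, mul_one, jointP, hj', hR']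
    exact mul_pos hμω' hπω
  obtain ⟨ε, ⟨hεpq, hε1⟩, hε0⟩ : ∃ ε : ℝ, ((∀ ωR a, ε * p ωR a ≤ q ωR a) ∧ ε ≤ 1) ∧ 0 < ε := by
    have hev : ∀ᶠ ε : ℝ in nhdsWithin 0 (Set.Ioi 0), (∀ ωR a, ε * p ωR a ≤ q ωR a) ∧ ε ≤ 1 := by
      refine (Filter.eventually_all.2 fun ωR => Filter.eventually_all.2 fun a => ?_).and ?_
      · rcases (hp0 ωR a).eq_or_lt with h0 | h0
        · exact Filter.Eventually.of_forall fun ε => by simpa [← h0] using hq0 ωR a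
        · have ht : Filter.Tendsto (fun ε : ℝ => ε * p ωR a) (nhds 0) (nhds (0 * p ωR a)) :=
            (continuous_id.mul continuous_const).tendsto 0
          rw [zero_mul] at ht
          exact nhdsWithin_le_nhds ((ht.eventually_lt_const (hpq ωR a h0)).mono
            fun _ hlt => hlt.le)
      · exact nhdsWithin_le_nhds (eventually_le_nhds (by norm_num))
    obtain ⟨ε, h1, h2⟩ := (hev.and self_mem_nhdsWithin).exists
    exact ⟨ε, h1, h2⟩
  let τ : Ω i × ΩR → A → ℝ := fun s a =>
    if aligned s then σ s a * (ε * p s.2 a / q s.2 a) else 0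
  have hr0 : ∀ ωR a, 0 ≤ ε * p ωR a / q ωR a := fun ωR a =>
    div_nonneg (mul_nonneg hε0.le (hp0 ωR a)) (hq0 ωR a)
  have hτ0 : ∀ s a, 0 ≤ τ s a := by
    intro s a
    simp only [τ]
    split_ifs
    · exact mul_nonneg (hσ.1 s a) (hr0 _ _)
    · exact le_rfl
  have hτ1 : ∀ s a, τ s a ≤ σ s a := by
    intro s a
    simp only [τ]
    split_ifs
    · exact mul_le_of_le_one_right (hσ.1 s a) (div_le_one_of_le₀ (hεpq _ _) (hq0 _ _))
    · exact hσ.1 s a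
  have hτ : ∀ a (g : ΩR → ℝ),
      ∑ ω, jointP μ0 τ ω a * g ω.2 = ε * ∑ ω, jointP μ0 σ ω a * g ω.2 := by
    intro a g
    have hL : ∑ ω, jointP μ0 τ ω a * g ω.2
        = ∑ ωR, q ωR a * (ε * p ωR a / q ωR a) * g ωR := by
      simp only [q, sum_mul]
      rw [sum_comm]
      refine sum_congr rfl fun ω _ => ?_
      rw [sum_eq_single ω.2 (fun ωR _ hne => by simp [hne.symm]) (by simp)]
      by_cases hal : aligned (ω.1 i, ω.2)
      · simp only [jointP, τ, hal, if_true, q, and_self]; ring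
      · simp [jointP, τ, hal]
    have hRt : ∑ ω, jointP μ0 σ ω a * g ω.2 = ∑ ωR, p ωR a * g ωR := by
      simp only [p, sum_mul]
      rw [sum_comm]
      refine sum_congr rfl fun ω _ => ?_
      rw [sum_eq_single ω.2 (fun ωR _ hne => by simp [hne.symm]) (by simp)]
      simp
    rw [hL, hRt, mul_sum]
    refine sum_congr rfl fun ωR _ => ?_
    rcases (hp0 ωR a).eq_or_lt with h0 | h0
    · simp [← h0]
    · rw [mul_div_cancel₀ _ (hpq ωR a h0).ne', mul_assoc]
  refine ⟨reveal best σ τ, isSignal_reveal best hσ hτ0 hτ1,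
    IC_reveal hμ0 (fun ωR => le_of_argmaxSet_eq_singleton (hbest ωR)) hσ hσIC hτ0 hτ1 hε1 hτ,
    ?_, ?_⟩
  · rw [← hσR]
    refine vR_lt_vR_reveal hε0 hτ ?_
    rw [sum_jointP_mul μ0 hσ (fun ω => uR (best ω.2) ω.2),
      ← sum_jointP_mul μ0 hπ (fun ω => uR (best ω.2) ω.2), hσR]
    exact vR_lt_first_best hμ0 hbest hπ h
  · rw [← hσS, vS, vS, sum_reveal μ0 best σ τ (fun a ω => u i a (ω.1 i))]
    refine lt_add_of_pos_right _ ?_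
    have hnn : ∀ a ω, 0 ≤ jointP μ0 τ ω a * (u i (best ω.2) (ω.1 i) - u i a (ω.1 i)) := by
      intro a ω
      by_cases hal : aligned (ω.1 i, ω.2)
      · exact mul_nonneg (mul_nonneg (hμ0 ω) (hτ0 _ a))
          (sub_nonneg.2 (le_of_argmaxSet_eq_singleton hal a))
      · simp [jointP, τ, hal]
    obtain ⟨a, ω, hpos, hne⟩ := h
    have hmass : 0 < ∑ ω', jointP μ0 τ ω' a * if ω'.2 = ω.2 then 1 else 0 := by
      rw [hτ a (fun ωR => if ωR = ω.2 then 1 else 0),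
        hcopy a (fun s => if s.2 = ω.2 then 1 else 0)]
      refine mul_pos hε0 (sum_pos' (fun ω' _ => mul_nonneg (mul_nonneg (hμ0 ω') (hπ.1 _ a))
        (by split_ifs <;> norm_num)) ⟨ω, mem_univ _, by simpa using hpos⟩)
    obtain ⟨ω', -, hω'⟩ := exists_lt_of_sum_lt (s := univ) (f := fun _ => (0 : ℝ))
      (by simpa using hmass)
    have hR' : ω'.2 = ω.2 := by
      by_contra hc
      simp [hc] at hω'
    have hτpos : 0 < jointP μ0 τ ω' a := by simpa [hR'] using hω'
    have hal : aligned (ω'.1 i, ω'.2) := by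
      by_contra hc
      simp [jointP, τ, hc] at hτpos
    refine sum_pos' (fun a _ => sum_nonneg fun ω _ => hnn a ω)
      ⟨a, mem_univ _, sum_pos' (fun ω _ => hnn a ω) ⟨ω', mem_univ _, ?_⟩⟩
    exact mul_pos hτpos (sub_pos.2 (lt_of_argmaxSet_eq_singleton hal (hR' ▸ hne)))

/-- A sender can raise the receiver's value at an arbitrarily small cost to himself. -/
lemma exists_perturbation {μ0 : ((∀ k, Ω k) × ΩR) → ℝ} (hμ0 : ∀ ω, 0 ≤ μ0 ω)
    {uR : A → ΩR → ℝ} {best : ΩR → A} (hbest : ∀ ωR, argmaxSet (fun a => uR a ωR) = {best ωR})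
    {i : Fin n} (ui : A → Ω i → ℝ) {π : Ω i × ΩR → A → ℝ} (hπ : IsSignal π)
    (hIC : IC μ0 π uR) (h : ∃ a ω, 0 < jointP μ0 π ω a ∧ a ≠ best ω.2)
    {c : ℝ} (hc : c < vS μ0 π i ui) :
    ∃ π' : Ω i × ΩR → A → ℝ, IsSignal π' ∧ IC μ0 π' uR ∧ vR μ0 π uR < vR μ0 π' uR ∧
      c < vS μ0 π' i ui := by
  let d : ℝ := ∑ a, ∑ ω, jointP μ0 π ω a * (ui (best ω.2) (ω.1 i) - ui a (ω.1 i))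
  obtain ⟨ε, ⟨hεc, hε1⟩, hε0⟩ : ∃ ε : ℝ, (c < vS μ0 π i ui + ε * d ∧ ε ≤ 1) ∧ 0 < ε := by
    have ht : Filter.Tendsto (fun ε : ℝ => vS μ0 π i ui + ε * d) (nhds 0)
        (nhds (vS μ0 π i ui + 0 * d)) :=
      (continuous_const.add (continuous_id.mul continuous_const)).tendsto 0
    rw [zero_mul, add_zero] at ht
    have hev : ∀ᶠ ε : ℝ in nhdsWithin 0 (Set.Ioi 0), c < vS μ0 π i ui + ε * d ∧ ε ≤ 1 :=
      nhdsWithin_le_nhds ((ht.eventually_const_lt hc).and (eventually_le_nhds (by norm_num)))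
    obtain ⟨ε, h1, h2⟩ := (hev.and self_mem_nhdsWithin).exists
    exact ⟨ε, h1, h2⟩
  let τ : Ω i × ΩR → A → ℝ := fun s a => ε * π s a
  have hj : ∀ ω a, jointP μ0 τ ω a = ε * jointP μ0 π ω a := fun ω a => by
    simp only [jointP, τ]; ring
  have hτ0 : ∀ s a, 0 ≤ τ s a := fun s a => mul_nonneg hε0.le (hπ.1 s a)
  have hτ1 : ∀ s a, τ s a ≤ π s a := fun s a => mul_le_of_le_one_left (hπ.1 s a) hε1
  have hτ : ∀ a (g : ΩR → ℝ),
      ∑ ω, jointP μ0 τ ω a * g ω.2 = ε * ∑ ω, jointP μ0 π ω a * g ω.2 := fun a g => by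
    simp only [hj, mul_sum, mul_assoc]
  refine ⟨reveal best π τ, isSignal_reveal best hπ hτ0 hτ1,
    IC_reveal hμ0 (fun ωR => le_of_argmaxSet_eq_singleton (hbest ωR)) hπ hIC hτ0 hτ1 hε1 hτ,
    vR_lt_vR_reveal hε0 hτ (vR_lt_first_best hμ0 hbest hπ h), ?_⟩
  rw [vS, sum_reveal μ0 best π τ (fun a ω => ui a (ω.1 i))]
  simp only [hj, mul_assoc, ← mul_sum]
  exact hεc

/-- In equilibrium, no signal that beats the receiver's equilibrium value gives its sender
more than his equilibrium payoff. -/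
lemma PureNE.vS_le {μ0 : ((∀ k, Ω k) × ΩR) → ℝ} {uR : A → ΩR → ℝ}
    {u : ∀ k : Fin n, A → Ω k → ℝ} {π : ∀ k : Fin n, Ω k × ΩR → A → ℝ}
    (hNE : PureNE μ0 π uR u) {j : Fin n} (hj : j ∈ BestSet μ0 π uR) {i : Fin n}
    {π' : Ω i × ΩR → A → ℝ} (hs : IsSignal π') (hIC : IC μ0 π' uR)
    (hlt : vR μ0 (π j) uR < vR μ0 π' uR) :
    vS μ0 π' i (u i) ≤ senderPayoff μ0 π uR i (u i) := by
  have hlt' : ∀ k, vR μ0 (π k) uR < vR μ0 π' uR := fun k =>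
    ((mem_filter.1 hj).2 k).trans_lt hlt
  have hB : BestSet μ0 (Function.update π i π') uR = {i} := by
    ext k
    simp only [BestSet, mem_filter, mem_univ, true_and, mem_singleton]
    constructor
    · intro hk
      by_contra hne
      have := hk i
      rw [Function.update_self, Function.update_of_ne hne] at this
      exact absurd (hlt' k) this.not_gt
    · rintro rfl l
      rw [Function.update_self]
      rcases eq_or_ne l k with rfl | hne
      · rw [Function.update_self]
      · rw [Function.update_of_ne hne]
        exact (hlt' l).le
  have := hNE.2 i π' hs hIC
  rwa [senderPayoff, hB, sum_singleton, card_singleton, Function.update_self, Nat.cast_one,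
    div_one] at this

/-- Theorem 1, pure-strategy case: with at least two senders and under
Assumptions 1 and 2, in every pure Nash equilibrium of the persuasion game with the uniform
tie-breaking decision rule, every signal chosen by the receiver with positive probability
(i.e., of every sender maximizing the receiver's value) is fully informative. -/
theorem main_theorem_pure
    [Nonempty A] [Nonempty ΩR] [∀ k, Nonempty (Ω k)]
    (hn : 2 ≤ n)
    (μ0 : ((∀ k, Ω k) × ΩR) → ℝ)
    (hμ0 : ∀ ω, 0 ≤ μ0 ω) (hμ1 : ∑ ω, μ0 ω = 1)
    (uR : A → ΩR → ℝ) (u : ∀ k : Fin n, A → Ω k → ℝ)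
    (hA1 : Assumption1 uR u) (hA2 : Assumption2 μ0 uR u)
    (π : ∀ k : Fin n, Ω k × ΩR → A → ℝ)
    (hNE : PureNE μ0 π uR u) :
    ∀ j ∈ BestSet μ0 π uR, FullyInformative μ0 (π j) uR := by
  obtain ⟨best, hbest⟩ : ∃ best : ΩR → A, ∀ ωR, argmaxSet (fun a => uR a ωR) = {best ωR} :=
    Classical.skolem.1 fun ωR => card_eq_one.1 (hA1.1 ωR)
  intro j₀ hj₀
  by_contra hnot
  have hval : ∀ j ∈ BestSet μ0 π uR, vR μ0 (π j) uR = vR μ0 (π j₀) uR := fun j hj =>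
    le_antisymm ((mem_filter.1 hj₀).2 j) ((mem_filter.1 hj).2 j₀)
  have hmis : ∀ j ∈ BestSet μ0 π uR, ∃ a ω, 0 < jointP μ0 (π j) ω a ∧ a ≠ best ω.2 := by
    intro j hj
    by_contra! hc
    have hfirst : vR μ0 (π j) uR = ∑ a, ∑ ω, jointP μ0 (π j) ω a * uR (best ω.2) ω.2 := by
      refine sum_congr rfl fun a _ => sum_congr rfl fun ω _ => ?_
      have hnn : 0 ≤ jointP μ0 (π j) ω a := mul_nonneg (hμ0 ω) ((hNE.1 j).1.1 _ a)
      rcases hnn.eq_or_lt with h0 | h0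
      · rw [← h0, zero_mul, zero_mul]
      · rw [← hc a ω h0]
    have := vR_lt_first_best hμ0 hbest (hNE.1 j₀).1 (exists_of_not_fullyInformative hbest hnot)
    rw [sum_jointP_mul μ0 (hNE.1 j₀).1 (fun ω => uR (best ω.2) ω.2),
      ← sum_jointP_mul μ0 (hNE.1 j).1 (fun ω => uR (best ω.2) ω.2), ← hfirst, hval j hj] at this
    exact lt_irrefl _ this
  have hless : ∀ i, ∀ j ∈ BestSet μ0 π uR, i ≠ j →
      vS μ0 (π j) i (u i) < senderPayoff μ0 π uR i (u i) := by
    intro i j hj hij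
    obtain ⟨π', hs, hIC, hR, hS⟩ := exists_improvement hμ0 hA2 hbest hij (hNE.1 j).1
      (hNE.1 j).2 (hmis j hj)
    exact hS.trans_le (hNE.vS_le hj hs hIC hR)
  have hself : ∀ i ∈ BestSet μ0 π uR,
      vS μ0 (π i) i (u i) ≤ senderPayoff μ0 π uR i (u i) := by
    intro i hi
    by_contra! hc
    obtain ⟨π', hs, hIC, hR, hS⟩ := exists_perturbation hμ0 hbest (u i) (hNE.1 i).1
      (hNE.1 i).2 (hmis i hi) hc
    exact hS.not_ge (hNE.vS_le hi hs hIC hR)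
  have : Nontrivial (Fin n) := Fin.nontrivial_iff_two_le.2 hn
  obtain ⟨i, hi⟩ := exists_ne j₀
  have hlt : ∑ j ∈ BestSet μ0 π uR, vS μ0 (π j) i (u i)
      < ∑ j ∈ BestSet μ0 π uR, senderPayoff μ0 π uR i (u i) := by
    refine sum_lt_sum (fun j hj => ?_) ⟨j₀, hj₀, hless i j₀ hj₀ hi⟩
    rcases eq_or_ne i j with rfl | hij
    · exact hself i hj
    · exact (hless i j hj hij).le
  have hcard : ((BestSet μ0 π uR).card : ℝ) ≠ 0 := by
    exact_mod_cast (card_pos.2 ⟨j₀, hj₀⟩).ne'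
  have havg : (BestSet μ0 π uR).card * senderPayoff μ0 π uR i (u i)
      = ∑ j ∈ BestSet μ0 π uR, vS μ0 (π j) i (u i) := by
    rw [senderPayoff, mul_div_cancel₀ _ hcard]
  rw [sum_const, nsmul_eq_mul, havg] at hlt
  exact lt_irrefl _ hlt
end Persuasion
end
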